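/- Let p be a prime, M an abelian group with an external Frobenius φ, and n ≥ 1. Define f^w : ∏_{i=0}^{n−1} M^{⊗p^i} → ∏_{j=0}^{n−1} M^{⊗p^j} by f^w(a_0,…,a_{n−1})_j = Σ_{i=0}^{j} Σ_{l=0}^{p^i−1} σ_j^l(φ^{(j−i)}(a_i)), where φ^{(k)} : M^{⊗p^i} → M^{⊗p^{i+k}} denotes the k-fold iterated higher Frobenius φ_{i+k−1} ∘ ⋯ ∘ φ_{i+1} ∘ φ_i (with φ^{(0)} = id). Then the image of f^w equals the image of the ghost map w : ∏_{i=0}^{n−1} M^{⊗p^i} → ∏_{j=0}^{n−1} M^{⊗p^j}; that is, a tuple b admits a preimage under w if and only if it admits a preimage under f^w. -/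

import Mathlib

open scoped TensorProduct

section Digits

/-- Identification of digit tuples `(Fin p)^m` (first digit most significant) with `Fin (p^m)`
via base-`p` digits. -/
def msbEquiv (p m : ℕ) : (Fin m → Fin p) ≃ Fin (p ^ m) :=
  (Equiv.piCongrLeft' (fun _ => Fin p) Fin.revPerm).trans finFunctionFinEquiv

/-- The digit rotation `τ_m : (i_1, …, i_m) ↦ (i_m, i_1, …, i_{m-1})` of digit tuples. -/
def rotPerm (p m : ℕ) [NeZero m] : Equiv.Perm (Fin m → Fin p) :=
  Equiv.piCongrLeft' (fun _ => Fin p) (Equiv.addRight (1 : Fin m))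

/-- The permutation of `Fin (p^m)` corresponding to a permutation of digit tuples. -/
def digitPerm (p m : ℕ) (e : Equiv.Perm (Fin m → Fin p)) : Equiv.Perm (Fin (p ^ m)) :=
  Equiv.permCongr (msbEquiv p m) e

end Digits

noncomputable section Tensor

/-- The `m`-fold tensor power over `ℤ` of an abelian group `A`, indexed by `Fin m`. -/
abbrev Tp (A : Type*) [AddCommGroup A] (m : ℕ) : Type _ := ⨂[ℤ] _ : Fin m, A

/-- The action of a permutation `e` of `Fin m` on the tensor power, by reindexing. -/
def permT (A : Type*) [AddCommGroup A] (m : ℕ) (e : Equiv.Perm (Fin m)) :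
    Tp A m ≃ₗ[ℤ] Tp A m :=
  PiTensorProduct.reindex ℤ (fun _ : Fin m => A) e

/-- The cyclic permutation `σ_m` on the tensor power, induced by reindexing along
`x ↦ x + 1` on `Fin m`, so that `σ(a_1 ⊗ ⋯ ⊗ a_m) = a_m ⊗ a_1 ⊗ ⋯ ⊗ a_{m-1}`. -/
def sigmaT (A : Type*) [AddCommGroup A] (m : ℕ) [NeZero m] : Tp A m ≃ₗ[ℤ] Tp A m :=
  permT A m (Equiv.addRight (1 : Fin m))

/-- The norm (transfer) map `N_m = Σ_{s=0}^{m-1} σ_m^s` on the tensor power. -/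
def normT (A : Type*) [AddCommGroup A] (m : ℕ) [NeZero m] : Tp A m → Tp A m :=
  fun x => ∑ s ∈ Finset.range m, (⇑(sigmaT A m))^[s] x

/-- Identification of tensor powers of equal sizes. -/
def tcast {A : Type*} [AddCommGroup A] {a b : ℕ} (h : a = b) : Tp A a ≃ₗ[ℤ] Tp A b :=
  TensorPower.cast ℤ A h

/-- Flattening of an iterated tensor power: `(A^{⊗N})^{⊗q} ≃ A^{⊗(N·q)}`, grouping
consecutive blocks of length `N`. -/
def flattenE (A : Type*) [AddCommGroup A] (N : ℕ) : (q : ℕ) →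
    (⨂[ℤ] _ : Fin q, Tp A N) ≃ₗ[ℤ] Tp A (N * q)
  | 0 => (PiTensorProduct.isEmptyEquiv (Fin 0)).trans
      (PiTensorProduct.isEmptyEquiv (Fin 0)).symm
  | q + 1 =>
      (TensorPower.mulEquiv (R := ℤ) (M := Tp A N) (n := q) (m := 1)).symm.trans <|
      (TensorProduct.congr (flattenE A N q)
        (PiTensorProduct.subsingletonEquiv (0 : Fin 1))).trans <|
      TensorPower.mulEquiv (R := ℤ) (M := A) (n := N * q) (m := N)

/-- The elementary tensor `c^{⊗B} ∈ A^{⊗(N·B)}` whose `B` consecutive blocks of length `N`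
all equal `c ∈ A^{⊗N}`. -/
def tpow {A : Type*} [AddCommGroup A] {N : ℕ} (c : Tp A N) (B : ℕ) : Tp A (N * B) :=
  flattenE A N B (PiTensorProduct.tprod ℤ (fun _ : Fin B => c))

/-- `c^{⊗B}`, recast to live in `A^{⊗m}` along an identification `N * B = m`. -/
def tpowTo {A : Type*} [AddCommGroup A] {N : ℕ} (c : Tp A N) (B : ℕ) {m : ℕ}
    (h : N * B = m) : Tp A m :=
  tcast (A := A) h (tpow c B)

end Tensor

noncomputable section Frobenius

variable (p : ℕ) [NeZero p] {M : Type*} [AddCommGroup M]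

/-- `φ^{⊗q}` : applies an additive map `φ : M → M^{⊗p}` to each of the `q` tensor factors,
the `p` outputs of each application of `φ` occupying a consecutive block of length `p`. -/
def frobT (φ : M →+ Tp M p) (q : ℕ) : Tp M q →ₗ[ℤ] Tp M (p * q) :=
  (flattenE M p q).toLinearMap ∘ₗ
    PiTensorProduct.map (fun _ : Fin q => φ.toIntLinearMap)

/-- The higher Frobenius `φ_n : M^{⊗p^n} → M^{⊗p^{n+1}}`, the composite of `φ^{⊗p^n}`
(outputs of `φ` in the last base-`p` digit) followed by the action of the digit rotation
`τ_{n+1}`. -/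
def higherFrob (φ : M →+ Tp M p) (n : ℕ) : Tp M (p ^ n) →ₗ[ℤ] Tp M (p ^ (n + 1)) :=
  (permT M (p ^ (n + 1)) (digitPerm p (n + 1) (rotPerm p (n + 1)))).toLinearMap ∘ₗ
    (tcast (A := M) (pow_succ' p n).symm).toLinearMap ∘ₗ frobT p φ (p ^ n)

/-- An external Frobenius on an abelian group `M` (for the prime `p`): an additive map
`φ : M → M^{⊗p}` landing in the `σ_1`-invariants and congruent to `m ↦ m^{⊗p}` modulo the
image of the norm map `N_p = Σ_{s=0}^{p-1} σ_1^s`. -/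
structure ExternalFrobenius (M : Type*) [AddCommGroup M] : Type _ where
  toFun : M →+ Tp M p
  fixed : ∀ m : M, sigmaT M p (toFun m) = toFun m
  congr_pow : ∀ m : M,
    toFun m - PiTensorProduct.tprod ℤ (fun _ : Fin p => m) ∈ Set.range (normT M p)

end Frobenius

/-- The ghost map: its `j`-th component is
`w_j(m_0, …, m_{n-1}) = Σ_{i=0}^{j} Σ_{l=0}^{p^i - 1} σ_j^l (m_i^{⊗p^{j-i}})`. -/
noncomputable def ghost (p : ℕ) [NeZero p] (M : Type*) [AddCommGroup M] (n : ℕ)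
    (m : ∀ i : Fin n, Tp M (p ^ (i : ℕ))) : ∀ j : Fin n, Tp M (p ^ (j : ℕ)) :=
  fun j => ∑ i : Fin n,
    if h : (i : ℕ) ≤ (j : ℕ) then
      ∑ l ∈ Finset.range (p ^ (i : ℕ)),
        (⇑(sigmaT M (p ^ (j : ℕ))))^[l]
          (tpowTo (m i) (p ^ ((j : ℕ) - (i : ℕ)))
            (by rw [← pow_add, Nat.add_sub_cancel' h]))
    else 0


/-- The `k`-fold iterated higher Frobenius `φ^{(k)} = φ_{i+k-1} ∘ ⋯ ∘ φ_{i+1} ∘ φ_i`. -/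
noncomputable def iterFrob (p : ℕ) [NeZero p] {M : Type*} [AddCommGroup M]
    (φ : M →+ Tp M p) (i : ℕ) : (k : ℕ) → Tp M (p ^ i) →ₗ[ℤ] Tp M (p ^ (i + k))
  | 0 => LinearMap.id
  | k + 1 => (higherFrob p φ (i + k)).comp (iterFrob p φ i k)

/-- The map `f^w`, with `j`-th component
`Σ_{i=0}^{j} Σ_{l=0}^{p^i - 1} σ_j^l (φ^{(j-i)}(a_i))`. -/
noncomputable def fw (p : ℕ) [NeZero p] (M : Type*) [AddCommGroup M] (φ : M →+ Tp M p)
    (n : ℕ) (a : ∀ i : Fin n, Tp M (p ^ (i : ℕ))) : ∀ j : Fin n, Tp M (p ^ (j : ℕ)) :=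
  fun j => ∑ i : Fin n,
    if h : (i : ℕ) ≤ (j : ℕ) then
      ∑ l ∈ Finset.range (p ^ (i : ℕ)),
        (⇑(sigmaT M (p ^ (j : ℕ))))^[l]
          (tcast (A := M)
            (show p ^ ((i : ℕ) + ((j : ℕ) - (i : ℕ))) = p ^ (j : ℕ) by
              rw [Nat.add_sub_cancel' h])
            (iterFrob p φ (i : ℕ) ((j : ℕ) - (i : ℕ)) (a i)))
    else 0

section Combinatorics

/-- Reindexing a sum over `range (a * b)` by division with remainder. -/
theorem sum_range_mul_eq {A : Type*} [AddCommMonoid A] (a b : ℕ) (f : ℕ → A) :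
    ∑ x ∈ Finset.range (a * b), f x =
      ∑ l ∈ Finset.range a, ∑ s ∈ Finset.range b, f (a * s + l) := by
  induction b with
  | zero => simp
  | succ b ih =>
    rw [Nat.mul_succ, Finset.sum_range_add, ih, ← Finset.sum_add_distrib]
    simp only [Finset.sum_range_succ]

/-- If `e` is a self-map with `e^[p^(k+1)] = id`, then modulo the image of the transfer, the sum of
an equivariant family only sees the fixed points of `e^[p^k]`. -/
theorem sum_sub_sum_fixed_mem_range {S A : Type*} [AddCommGroup A] {p : ℕ}
    (hp : p.Prime) (k : ℕ) (e : S → S) (he : e^[p ^ (k + 1)] = id) (σ : A →+ A) (T : S → A)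
    (hT : ∀ s, T (e s) = σ (T s)) [DecidableEq S] (F : Finset S) (hF : ∀ s ∈ F, e s ∈ F) :
    ∃ z, ∑ s ∈ F, T s - ∑ s ∈ F with e^[p ^ k] s = s, T s =
      ∑ l ∈ Finset.range (p ^ (k + 1)), σ^[l] z := by
  have hiter : ∀ l s, T (e^[l] s) = σ^[l] (T s) := by
    intro l
    induction l with
    | zero => simp
    | succ l ih => intro s; rw [Function.iterate_succ_apply', Function.iterate_succ_apply', hT, ih]
  induction F using Finset.strongInduction with
  | H F ih =>
    by_cases hfix : ∀ s ∈ F, e^[p ^ k] s = s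
    · refine ⟨0, ?_⟩
      rw [Finset.filter_true_of_mem hfix]
      simp [iterate_map_zero]
    · push Not at hfix
      obtain ⟨s, hsF, hs⟩ := hfix
      have hper : Function.minimalPeriod e s = p ^ (k + 1) := by
        have hdvd : Function.minimalPeriod e s ∣ p ^ (k + 1) :=
          Function.IsPeriodicPt.minimalPeriod_dvd (by
            rw [Function.IsPeriodicPt, Function.IsFixedPt, he, id])
        obtain ⟨j, hj, hj'⟩ := (Nat.dvd_prime_pow hp).1 hdvd
        rcases Nat.lt_or_ge j (k + 1) with h | h
        · exact absurd (Function.isPeriodicPt_iff_minimalPeriod_dvd.2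
            (hj' ▸ pow_dvd_pow p (Nat.lt_succ_iff.1 h))) hs
        · rw [hj', le_antisymm hj h]
      have hfixs : ∀ t l, e^[p ^ k] (e^[l] t) = e^[l] (e^[p ^ k] t) := fun t l => by
        rw [← Function.iterate_add_apply, ← Function.iterate_add_apply, add_comm]
      set O := (Finset.range (p ^ (k + 1))).image (fun l => e^[l] s) with hO
      have hinj : Set.InjOn (fun l => e^[l] s) (Finset.range (p ^ (k + 1)) : Set ℕ) := by
        intro a ha b hb hab
        rw [Finset.coe_range, ← hper] at ha hb
        exact Function.iterate_injOn_Iio_minimalPeriod ha hb hab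
      have hOF : O ⊆ F := by
        intro t ht
        obtain ⟨l, -, rfl⟩ := Finset.mem_image.1 ht
        induction l with
        | zero => exact hsF
        | succ l ih =>
          rw [Function.iterate_succ_apply']
          by_cases hl : e^[l] s ∈ O
          · exact hF _ (ih hl)
          · exact absurd (Finset.mem_image.2 ⟨l % p ^ (k + 1),
              Finset.mem_range.2 (Nat.mod_lt _ (pow_pos hp.pos _)), by
                rw [← hper, Function.iterate_mod_minimalPeriod_eq]⟩) hl
      have hpow : e^[p ^ (k + 1) - 1 + 1] s = s := by
        rw [Nat.sub_add_cancel (Nat.one_le_pow _ _ hp.pos), he, id]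
      have heinj : Function.Injective e := by
        apply Function.Injective.of_comp (f := e^[p ^ (k + 1) - 1])
        rw [← Function.iterate_succ, Nat.succ_eq_add_one,
          Nat.sub_add_cancel (Nat.one_le_pow _ _ hp.pos), he]
        exact Function.injective_id
      have hnotO : ∀ t ∈ F \ O, e t ∈ F \ O := by
        intro t ht
        rw [Finset.mem_sdiff] at ht ⊢
        refine ⟨hF _ ht.1, fun hmem => ht.2 ?_⟩
        obtain ⟨l, hl, hlt⟩ := Finset.mem_image.1 hmem
        refine Finset.mem_image.2 ⟨(l + (p ^ (k + 1) - 1)) % p ^ (k + 1),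
          Finset.mem_range.2 (Nat.mod_lt _ (pow_pos hp.pos _)), heinj ?_⟩
        rw [← hlt, ← hper, Function.iterate_mod_minimalPeriod_eq, hper,
          ← Function.iterate_succ_apply' e, Nat.succ_eq_add_one, add_assoc,
          Function.iterate_add_apply, hpow]
      have hssub : F \ O ⊂ F := Finset.sdiff_ssubset hOF
        ⟨s, Finset.mem_image.2 ⟨0, Finset.mem_range.2 (pow_pos hp.pos _), rfl⟩⟩
      obtain ⟨z, hz⟩ := ih _ hssub hnotO
      refine ⟨z + T s, ?_⟩
      have hfilter : F.filter (fun t => e^[p ^ k] t = t) =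
          (F \ O).filter (fun t => e^[p ^ k] t = t) := by
        ext t
        simp only [Finset.mem_filter, Finset.mem_sdiff]
        refine ⟨fun h => ⟨⟨h.1, fun hmem => hs ?_⟩, h.2⟩, fun h => ⟨h.1.1, h.2⟩⟩
        obtain ⟨l, -, rfl⟩ := Finset.mem_image.1 hmem
        exact heinj.iterate l ((hfixs s l).symm.trans h.2)
      rw [hfilter, ← Finset.sum_sdiff hOF, add_sub_right_comm, hz]
      simp only [iterate_map_add, Finset.sum_add_distrib]
      rw [hO, Finset.sum_image hinj]
      simp only [hiter]

end Combinatorics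

section ElementaryTensors

variable {A : Type*} [AddCommGroup A]

/-- The elementary tensor of length `m` whose factors are the values of `v` on `0, …, m - 1`. -/
noncomputable def elemT (m : ℕ) (v : ℤ → A) : Tp A m :=
  PiTensorProduct.tprod ℤ (fun x : Fin m => v x)

theorem exists_elemT {m : ℕ} (hm : 0 < m) (f : Fin m → A) :
    ∃ v : ℤ → A, (∀ z, v (z - m) = v z) ∧ PiTensorProduct.tprod ℤ f = elemT m v := by
  have hlt : ∀ z : ℤ, (z % m).toNat < m := fun z => by
    have := Int.emod_lt_of_pos z (Int.natCast_pos.2 hm)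
    omega
  refine ⟨fun z => f ⟨(z % m).toNat, hlt z⟩, fun z => by simp only [Int.sub_emod_right], ?_⟩
  refine congrArg (PiTensorProduct.tprod ℤ) (funext fun x => congrArg f (Fin.ext ?_))
  simp [← Int.natCast_mod, Nat.mod_eq_of_lt x.2]

theorem exists_eq_sum_elemT {m : ℕ} (hm : 0 < m) (y : Tp A m) :
    ∃ (r : ℕ) (a : Fin r → ℤ → A),
      (∀ α z, a α (z - m) = a α z) ∧ y = ∑ α, elemT m (a α) := by
  induction y using PiTensorProduct.induction_on with
  | smul_tprod c f =>
    obtain ⟨v, hper, hv⟩ := exists_elemT hm (Function.update f ⟨0, hm⟩ (c • f ⟨0, hm⟩))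
    refine ⟨1, fun _ => v, fun _ => hper, ?_⟩
    rw [Fin.sum_univ_one, ← hv, MultilinearMap.map_update_smul, Function.update_eq_self]
  | add x y hx hy =>
    obtain ⟨r, a, ha, rfl⟩ := hx
    obtain ⟨s, b, hb, rfl⟩ := hy
    exact ⟨r + s, Fin.append a b, Fin.addCases (by simpa using ha) (by simpa using hb),
      by simp [Fin.sum_univ_add]⟩

/-- Multilinear maps on tensor powers agreeing on elementary tensors are equal. -/
theorem multilinear_ext_elemT {q m : ℕ} (hm : 0 < m) {B : Type*} [AddCommGroup B]
    {f g : MultilinearMap ℤ (fun _ : Fin q => Tp A m) B}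
    (h : ∀ c : Fin q → ℤ → A, (∀ s z, c s (z - m) = c s z) →
      f (fun s => elemT m (c s)) = g (fun s => elemT m (c s))) :
    f = g := by
  ext v
  choose r a hper ha using fun s => exists_eq_sum_elemT hm (v s)
  rw [show v = fun s => ∑ α, elemT m (a s α) from funext ha, MultilinearMap.map_sum,
    MultilinearMap.map_sum]
  exact Finset.sum_congr rfl fun t _ => h _ fun s => hper s (t s)

theorem permT_tprod (m : ℕ) (e : Equiv.Perm (Fin m)) (f : Fin m → A) :
    permT A m e (PiTensorProduct.tprod ℤ f) = PiTensorProduct.tprod ℤ (fun x => f (e.symm x)) :=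
  PiTensorProduct.reindex_tprod _ _

theorem tcast_elemT {a b : ℕ} (h : a = b) (v : ℤ → A) :
    tcast (A := A) h (elemT a v) = elemT b v := by
  subst h
  simp [tcast]

theorem Fin.intCast_val_sub_one {m : ℕ} [NeZero m] (x : Fin m) :
    (((x - 1 : Fin m) : ℕ) : ℤ) = if x = 0 then (m : ℤ) - 1 else (x : ℤ) - 1 := by
  obtain ⟨k, rfl⟩ := Nat.exists_eq_succ_of_ne_zero (NeZero.ne m)
  rw [Fin.coe_sub_one]
  split_ifs with h
  · simp
  · have : (x : ℕ) ≠ 0 := fun h0 => h (Fin.ext h0)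
    omega

theorem sigmaT_elemT (m : ℕ) [NeZero m] (v : ℤ → A) (hv : ∀ z, v (z - m) = v z) :
    sigmaT A m (elemT m v) = elemT m (fun z => v (z - 1)) := by
  rw [sigmaT, elemT, permT_tprod]
  refine congrArg (PiTensorProduct.tprod ℤ) (funext fun x => ?_)
  have hx : (Equiv.addRight (1 : Fin m)).symm x = x - 1 := by
    rw [Equiv.symm_apply_eq]
    simp
  rw [hx, Fin.intCast_val_sub_one]
  split_ifs with h
  · rw [h, ← hv]
    congr 1
    simp
  · rfl

theorem flattenE_tprod (N q : ℕ) (c : ℕ → ℕ → A) :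
    flattenE A N q (PiTensorProduct.tprod ℤ fun s : Fin q =>
      PiTensorProduct.tprod ℤ fun r : Fin N => c s r) =
    PiTensorProduct.tprod ℤ fun x : Fin (N * q) => c (x / N) (x % N) := by
  induction q with
  | zero =>
    rw [flattenE, LinearEquiv.trans_apply, PiTensorProduct.isEmptyEquiv_apply_tprod,
      LinearEquiv.symm_apply_eq]
    exact (PiTensorProduct.isEmptyEquiv_apply_tprod (R := ℤ) (Fin 0) _).symm
  | succ q ih =>
    have hsplit : (TensorPower.mulEquiv (R := ℤ) (M := Tp A N) (n := q) (m := 1)).symm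
        (PiTensorProduct.tprod ℤ fun s : Fin (q + 1) =>
          PiTensorProduct.tprod ℤ fun r : Fin N => c s r) =
        (PiTensorProduct.tprod ℤ fun s : Fin q =>
          PiTensorProduct.tprod ℤ fun r : Fin N => c s r) ⊗ₜ[ℤ]
        (PiTensorProduct.tprod ℤ fun _ : Fin 1 =>
          PiTensorProduct.tprod ℤ fun r : Fin N => c q r) := by
      rw [LinearEquiv.symm_apply_eq, ← TensorPower.gMul_def, TensorPower.tprod_mul_tprod]
      refine congrArg (PiTensorProduct.tprod ℤ) (funext fun s => ?_)
      refine Fin.addCases (fun s => ?_) (fun s => ?_) s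
      · simp
      · simp
    rw [flattenE, LinearEquiv.trans_apply, LinearEquiv.trans_apply, hsplit,
      TensorProduct.congr_tmul, ih, PiTensorProduct.subsingletonEquiv_apply_tprod,
      ← TensorPower.gMul_def, TensorPower.tprod_mul_tprod]
    refine congrArg (PiTensorProduct.tprod ℤ) (funext fun x => ?_)
    refine Fin.addCases (fun x => ?_) (fun x => ?_) x
    · simp
    · have hN : 0 < N := x.pos
      rw [Fin.append_right, Fin.val_natAdd, Nat.mul_add_div hN, Nat.div_eq_of_lt x.2,
        Nat.mul_add_mod, Nat.mod_eq_of_lt x.2, add_zero]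

end ElementaryTensors

section Gluing

theorem msbEquiv_val_succ (p n : ℕ) (f : Fin (n + 1) → Fin p) :
    (msbEquiv p (n + 1) f : ℕ) =
      f (Fin.last n) + p * (msbEquiv p n (fun i => f i.castSucc) : ℕ) := by
  simp only [msbEquiv, Equiv.trans_apply, finFunctionFinEquiv_apply, Fin.sum_univ_succ,
    Finset.mul_sum]
  congr 1
  · simp
  · refine Finset.sum_congr rfl fun i _ => ?_
    simp [Fin.rev_succ, pow_succ]
    ring

theorem digitPerm_rotPerm_val (p n : ℕ) (y : Fin (p ^ (n + 1))) :
    (digitPerm p (n + 1) (rotPerm p (n + 1)) y : ℕ) = (y % p) * p ^ n + y / p := by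
  obtain ⟨f, rfl⟩ := (msbEquiv p (n + 1)).surjective y
  have hp : 0 < p := (f 0).pos
  have hrot : ∀ i : Fin (n + 1), rotPerm p (n + 1) f i = f (i - 1) := fun i => by
    have : (Equiv.addRight (1 : Fin (n + 1))).symm i = i - 1 := by
      rw [Equiv.symm_apply_eq]; simp
    rw [← this]; rfl
  have hlast : (msbEquiv p (n + 1) (rotPerm p (n + 1) f) : ℕ) =
      f (Fin.last n) * p ^ n + (msbEquiv p n (fun i => f i.castSucc) : ℕ) := by
    simp only [msbEquiv, Equiv.trans_apply, finFunctionFinEquiv_apply, Fin.sum_univ_castSucc]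
    rw [add_comm]
    have hrev : ∀ i : Fin (n + 1), Equiv.piCongrLeft' (fun _ => Fin p) Fin.revPerm
        (rotPerm p (n + 1) f) i = f (Fin.rev i - 1) := fun i => hrot _
    congr 1
    · have : (0 : Fin (n + 1)) - 1 = Fin.last n := by
        rw [sub_eq_iff_eq_add, Fin.last_add_one]
      rw [hrev, Fin.rev_last, this, Fin.val_last]
    · refine Finset.sum_congr rfl fun i _ => ?_
      have : (Fin.rev i).succ - 1 = (Fin.rev i).castSucc := by
        rw [sub_eq_iff_eq_add, Fin.coeSucc_eq_succ]
      rw [hrev, Fin.rev_castSucc, this]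
      rfl
  rw [digitPerm, Equiv.permCongr_apply, Equiv.symm_apply_apply, hlast, msbEquiv_val_succ,
    Nat.add_mul_mod_self_left, Nat.mod_eq_of_lt (f _).2, Nat.add_mul_div_left _ _ hp,
    Nat.div_eq_of_lt (f _).2, zero_add]

theorem digitPerm_rotPerm_symm_val (p n : ℕ) [NeZero p] (x : Fin (p ^ (n + 1))) :
    ((digitPerm p (n + 1) (rotPerm p (n + 1))).symm x : ℕ) = p * (x % p ^ n) + x / p ^ n := by
  obtain ⟨y, rfl⟩ := (digitPerm p (n + 1) (rotPerm p (n + 1))).surjective x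
  have hy : (y : ℕ) / p < p ^ n := Nat.div_lt_of_lt_mul (by rw [← pow_succ']; exact y.2)
  rw [Equiv.symm_apply_apply, digitPerm_rotPerm_val, mul_comm (_ % _), Nat.mul_add_mod,
    Nat.mod_eq_of_lt hy, Nat.mul_add_div (NeZero.pos (p ^ n)), Nat.div_eq_of_lt hy, add_zero, Nat.div_add_mod]

variable (p : ℕ) (M : Type*) [AddCommGroup M]

/-- Glue `p^n` tensors of length `p` into one of length `p^(n+1)`, the `r`-th factor of the `q`-th
tensor being put at position `r * p^n + q`. -/
noncomputable def glue (n : ℕ) :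
    MultilinearMap ℤ (fun _ : Fin (p ^ n) => Tp M p) (Tp M (p ^ (n + 1))) :=
  ((permT M (p ^ (n + 1)) (digitPerm p (n + 1) (rotPerm p (n + 1)))).toLinearMap ∘ₗ
    (tcast (A := M) (pow_succ' p n).symm).toLinearMap ∘ₗ
    (flattenE M p (p ^ n)).toLinearMap).compMultilinearMap (PiTensorProduct.tprod ℤ)

variable {M}

theorem higherFrob_tprod (φ : M →+ Tp M p) (n : ℕ) (b : Fin (p ^ n) → M) :
    higherFrob p φ n (PiTensorProduct.tprod ℤ b) = glue p M n fun q => φ (b q) := by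
  simp only [higherFrob, frobT, glue, LinearMap.comp_apply, PiTensorProduct.map_tprod]
  rfl

variable [NeZero p]

theorem glue_elemT (n : ℕ) (c : ℤ → ℤ → M) :
    glue p M n (fun q => elemT p (c q)) =
      elemT (p ^ (n + 1)) fun z => c (z % (p ^ n : ℕ)) (z / (p ^ n : ℕ)) := by
  have h := flattenE_tprod p (p ^ n) fun q r : ℕ => c q r
  simp only [glue, LinearMap.compMultilinearMap_apply, LinearMap.comp_apply, elemT,
    LinearEquiv.coe_coe]
  rw [h, tcast, TensorPower.cast_tprod, permT_tprod]
  refine congrArg (PiTensorProduct.tprod ℤ) (funext fun x => ?_)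
  have hx : (x : ℕ) / p ^ n < p :=
    Nat.div_lt_of_lt_mul (by rw [← pow_succ]; exact x.2)
  rw [Function.comp_apply, Fin.val_cast, digitPerm_rotPerm_symm_val,
    Nat.mul_add_div (NeZero.pos p), Nat.div_eq_of_lt hx, Nat.mul_add_mod, Nat.mod_eq_of_lt hx,
    add_zero]
  push_cast
  rfl

theorem sigmaT_glue_elemT (n : ℕ) (c : ℤ → ℤ → M) (hc : ∀ q z, c q (z - p) = c q z) :
    sigmaT M (p ^ (n + 1)) (glue p M n fun q => elemT p (c q)) =
      glue p M n fun q => elemT p fun z =>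
        c (((q : ℤ) - 1) % (p ^ n : ℕ)) (z + ((q : ℤ) - 1) / (p ^ n : ℕ)) := by
  have hP : ((p ^ n : ℕ) : ℤ) ≠ 0 := by exact_mod_cast NeZero.ne (p ^ n)
  rw [glue_elemT, glue_elemT p n fun q z =>
    c ((q - 1) % (p ^ n : ℕ)) (z + (q - 1) / (p ^ n : ℕ)), sigmaT_elemT]
  · congr 1
    funext z
    have hz : z - 1 = (z % (p ^ n : ℕ) - 1) + (p ^ n : ℕ) * (z / (p ^ n : ℕ)) := by
      have := Int.emod_add_mul_ediv z (p ^ n : ℕ)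
      linarith
    rw [hz, Int.add_mul_emod_self_left, Int.add_mul_ediv_left _ _ hP, add_comm (z / _)]
  · intro z
    have hz : z - (p ^ (n + 1) : ℕ) = z + (p ^ n : ℕ) * (-p) := by
      push_cast
      ring
    rw [hz, Int.add_mul_emod_self_left, Int.add_mul_ediv_left _ _ hP, ← sub_eq_add_neg, hc]

theorem sigmaT_glue (n : ℕ) (v : ℤ → Tp M p)
    (hv : ∀ z, v (z - (p ^ n : ℕ)) = sigmaT M p (v z)) :
    sigmaT M (p ^ (n + 1)) (glue p M n fun q => v q) =
      glue p M n fun q => v ((q : ℤ) - 1) := by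
  have hP : 0 < p ^ n := NeZero.pos _
  set tw : ∀ _ : Fin (p ^ n), Tp M p →ₗ[ℤ] Tp M p := fun q =>
    if q = 0 then (sigmaT M p).toLinearMap else LinearMap.id with htw
  have key : (sigmaT M (p ^ (n + 1))).toLinearMap.compMultilinearMap (glue p M n) =
      ((glue p M n).compLinearMap tw).domDomCongr (Equiv.subRight 1) := by
    refine multilinear_ext_elemT (NeZero.pos p) fun c hc => ?_
    obtain ⟨c', hc', hcc⟩ : ∃ c' : ℤ → ℤ → M, (∀ q z, c' q (z - p) = c' q z) ∧
        ∀ q : Fin (p ^ n), c q = c' q :=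
      ⟨fun q => if h : q.toNat < p ^ n then c ⟨q.toNat, h⟩ else 0,
        fun q z => by dsimp only; split_ifs <;> simp [hc], fun q => by simp⟩
    simp only [hcc, LinearMap.compMultilinearMap_apply, LinearEquiv.coe_coe,
      MultilinearMap.domDomCongr_apply, MultilinearMap.compLinearMap_apply]
    rw [sigmaT_glue_elemT p n c' hc']
    congr 1
    funext q
    rw [Equiv.subRight_apply, Fin.intCast_val_sub_one, htw]
    dsimp only
    split_ifs with h
    · rw [h, LinearEquiv.coe_coe, sigmaT_elemT _ _ (hc' _)]
      congr 1
      funext z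
      have h1 : ((0 : Fin (p ^ n)) : ℤ) - 1 = ((p ^ n : ℕ) : ℤ) - 1 + (p ^ n : ℕ) * (-1) := by
        rw [Fin.val_zero]
        ring
      have hlt : ((p ^ n : ℕ) : ℤ) - 1 < (p ^ n : ℕ) := by omega
      have hle : 0 ≤ ((p ^ n : ℕ) : ℤ) - 1 := by omega
      rw [h1, Int.add_mul_emod_self_left, Int.add_mul_ediv_left _ _ (by omega),
        Int.emod_eq_of_lt hle hlt, Int.ediv_eq_zero_of_lt hle hlt, zero_add, ← sub_eq_add_neg]
    · have h0 : (q : ℕ) ≠ 0 := fun h0 => h (Fin.ext h0)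
      have hle : 0 ≤ (q : ℤ) - 1 := by omega
      have hlt : (q : ℤ) - 1 < (p ^ n : ℕ) := by have := q.2; omega
      rw [Int.emod_eq_of_lt hle hlt, Int.ediv_eq_zero_of_lt hle hlt]
      simp
  have := congrArg (fun f => f fun q : Fin (p ^ n) => v q) key
  simp only [LinearMap.compMultilinearMap_apply, LinearEquiv.coe_coe] at this
  rw [this, MultilinearMap.domDomCongr_apply, MultilinearMap.compLinearMap_apply]
  congr 1
  funext q
  rw [Equiv.subRight_apply, Fin.intCast_val_sub_one, htw]
  dsimp only
  split_ifs with h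
  · rw [LinearEquiv.coe_coe, ← hv, h]
    congr 1
    simp
  · rfl

end Gluing

section TwistedPeriodic

variable {Λ : Type*} {N : ℕ} [NeZero N]

/-- The extension of `t : Fin N → Λ` to `ℤ` that satisfies `t (z - N) = ρ (t z)`. -/
def twExt (ρ : Equiv.Perm Λ) (t : Fin N → Λ) (z : ℤ) : Λ :=
  (ρ ^ (-(z / N))) (t (Fin.ofNat N (z % N).toNat))

/-- The translation by `l` of twisted periodic functions, in terms of their restriction to
a fundamental domain. -/
def twShift (ρ : Equiv.Perm Λ) (l : ℤ) (t : Fin N → Λ) : Fin N → Λ :=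
  fun x => twExt ρ t (x - l)

theorem twExt_add_mul (ρ : Equiv.Perm Λ) (t : Fin N → Λ) (z m : ℤ) :
    twExt ρ t (z + N * m) = (ρ ^ (-m)) (twExt ρ t z) := by
  have hN : (N : ℤ) ≠ 0 := by exact_mod_cast NeZero.ne N
  rw [twExt, twExt, Int.add_mul_emod_self_left, Int.add_mul_ediv_left _ _ hN,
    ← Equiv.Perm.mul_apply, ← zpow_add, neg_add_rev]

theorem twExt_sub (ρ : Equiv.Perm Λ) (t : Fin N → Λ) (z : ℤ) :
    twExt ρ t (z - N) = ρ (twExt ρ t z) := by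
  simpa [sub_eq_add_neg] using twExt_add_mul ρ t z (-1)

theorem twExt_val (ρ : Equiv.Perm Λ) (t : Fin N → Λ) (x : Fin N) : twExt ρ t x = t x := by
  have h0 : (x : ℤ) / N = 0 := Int.ediv_eq_zero_of_lt (by simp) (by simp)
  have h1 : (x : ℤ) % N = x := Int.emod_eq_of_lt (by simp) (by simp)
  rw [twExt, h0, h1]
  simp

theorem Fin.intCast_val_ofNat_toNat_emod (z : ℤ) :
    ((Fin.ofNat N (z % N).toNat : Fin N) : ℤ) = z % N := by
  have hN : (0 : ℤ) < N := by exact_mod_cast NeZero.pos N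
  have h0 := Int.emod_nonneg z hN.ne'
  have h1 := Int.emod_lt_of_pos z hN
  rw [Fin.val_ofNat, Nat.mod_eq_of_lt (by omega), Int.toNat_of_nonneg h0]

theorem twExt_twShift (ρ : Equiv.Perm Λ) (l : ℤ) (t : Fin N → Λ) (z : ℤ) :
    twExt ρ (twShift ρ l t) z = twExt ρ t (z - l) := by
  have hz : z - l = z % N - l + N * (z / N) := by
    have := Int.emod_add_mul_ediv z N
    linarith
  rw [hz, twExt_add_mul, twExt, twShift, Fin.intCast_val_ofNat_toNat_emod]

theorem twShift_iterate (ρ : Equiv.Perm Λ) (l : ℤ) (k : ℕ) (t : Fin N → Λ) :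
    (twShift ρ l)^[k] t = twShift ρ (k * l) t := by
  induction k with
  | zero =>
    funext x
    simp [twShift, twExt_val]
  | succ k ih =>
    funext x
    rw [Function.iterate_succ_apply', ih, twShift, twExt_twShift, twShift]
    congr 1
    push_cast
    ring

theorem twShift_mul (ρ : Equiv.Perm Λ) (m : ℕ) (t : Fin N → Λ) :
    twShift ρ (N * m : ℕ) t = fun x => (ρ ^ m) (t x) := by
  funext x
  have h : ((x : ℤ) - (N * m : ℕ)) = x + N * (-m) := by
    push_cast
    ring
  rw [twShift, h, twExt_add_mul, twExt_val]
  simp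

end TwistedPeriodic

section Transfer

variable {A : Type*} [AddCommGroup A]

theorem sigmaT_iterate_elemT (m : ℕ) [NeZero m] (v : ℤ → A) (hv : ∀ z, v (z - m) = v z) (l : ℕ) :
    (sigmaT A m)^[l] (elemT m v) = elemT m (fun z => v (z - l)) := by
  induction l with
  | zero => simp
  | succ l ih =>
    rw [Function.iterate_succ_apply', ih, sigmaT_elemT]
    · congr 1
      funext z
      congr 1
      push_cast
      ring
    · intro z
      rw [sub_right_comm, hv]

theorem sigmaT_iterate_self (m : ℕ) [NeZero m] (y : Tp A m) : (sigmaT A m)^[m] y = y := by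
  obtain ⟨r, a, ha, rfl⟩ := exists_eq_sum_elemT (NeZero.pos m) y
  rw [← LinearEquiv.coe_toLinearMap, ← Module.End.coe_pow, map_sum]
  refine Finset.sum_congr rfl fun α _ => ?_
  rw [Module.End.coe_pow, LinearEquiv.coe_toLinearMap, sigmaT_iterate_elemT _ _ (ha α)]
  congr 1
  exact funext (ha α)

theorem tpowTo_sum_elemT {N B m r : ℕ} [NeZero B] (h : N * B = m) (a : Fin r → ℤ → A) :
    tpowTo (∑ α, elemT N (a α)) B h =
      ∑ t : Fin B → Fin r, elemT m fun z => a (twExt 1 t (z / N)) (z % N) := by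
  rw [tpowTo, tpow, MultilinearMap.map_sum, map_sum, map_sum]
  refine Finset.sum_congr rfl fun t _ => ?_
  rw [← tcast_elemT h]
  congr 1
  have := flattenE_tprod N B fun s q : ℕ => a (twExt 1 t s) q
  simp only [twExt_val] at this
  exact this

variable (p : ℕ) [NeZero p] {M : Type*} [AddCommGroup M]

theorem sigmaT_iterate_glue (n : ℕ) (v : ℤ → Tp M p)
    (hv : ∀ z, v (z - (p ^ n : ℕ)) = sigmaT M p (v z)) (l : ℕ) :
    (sigmaT M (p ^ (n + 1)))^[l] (glue p M n fun q => v q) =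
      glue p M n fun q => v ((q : ℤ) - l) := by
  induction l with
  | zero => simp
  | succ l ih =>
    rw [Function.iterate_succ_apply', ih, sigmaT_glue p n (fun z => v (z - l))]
    · congr 1
      funext q
      congr 1
      push_cast
      ring
    · intro z
      rw [sub_right_comm, hv]

theorem higherFrob_sigmaT (φ : ExternalFrobenius p M) (n : ℕ) (y : Tp M (p ^ n)) :
    higherFrob p φ.toFun n (sigmaT M (p ^ n) y) =
      sigmaT M (p ^ (n + 1)) (higherFrob p φ.toFun n y) := by
  obtain ⟨r, a, ha, rfl⟩ := exists_eq_sum_elemT (NeZero.pos (p ^ n)) y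
  simp only [map_sum]
  refine Finset.sum_congr rfl fun α _ => ?_
  rw [sigmaT_elemT _ _ (ha α), elemT, elemT, higherFrob_tprod, higherFrob_tprod,
    sigmaT_glue p n fun z => φ.toFun (a α z)]
  intro z
  rw [ha, φ.fixed]

end Transfer

section Congruence

variable (p : ℕ) [NeZero p] {M : Type*} [AddCommGroup M]

/-- The permutation of `Option (Fin p)` fixing `none` and rotating `Fin p`. -/
def optRot : Equiv.Perm (Option (Fin p)) := Equiv.optionCongr (Equiv.addRight (1 : Fin p))

theorem optRot_pow (l : ℕ) :
    optRot p ^ l = Equiv.optionCongr (Equiv.addRight (Fin.ofNat p l)) := by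
  induction l with
  | zero => ext o; cases o <;> simp
  | succ l ih =>
    have h : Fin.ofNat p (l + 1) = Fin.ofNat p l + 1 := by
      apply Fin.ext
      simp [Fin.val_add]
    rw [pow_succ', ih, h]
    ext o
    cases o <;> simp [optRot, add_assoc]

theorem optRot_pow_self : optRot p ^ p = 1 := by
  rw [optRot_pow]
  ext o
  cases o <;> simp

theorem optRot_eq_self_iff (hp : p.Prime) (o : Option (Fin p)) : optRot p o = o ↔ o = none := by
  have := Fact.mk hp.one_lt
  cases o <;> simp [optRot, hp.ne_one]

/-- An external Frobenius is a sum of a `p`-th power and a rotated family of tensors. -/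
theorem ExternalFrobenius.exists_eq_sum (φ : ExternalFrobenius p M) :
    ∃ u : M → Option (Fin p) → Tp M p, (∀ m, u m none = elemT p fun _ => m) ∧
      (∀ m o, u m (optRot p o) = sigmaT M p (u m o)) ∧ ∀ m, φ.toFun m = ∑ o, u m o := by
  choose c hc using φ.congr_pow
  refine ⟨fun m o => o.elim (elemT p fun _ => m) fun g => (sigmaT M p)^[g] (c m), fun m => rfl,
    fun m o => ?_, fun m => ?_⟩
  · cases o with
    | none => exact (sigmaT_elemT p (fun _ => m) fun _ => rfl).symm
    | some g =>
      simp only [optRot, Equiv.optionCongr_apply, Option.map_some, Option.elim_some,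
        Equiv.coe_addRight]
      rw [← Function.iterate_succ_apply' (sigmaT M p), Fin.val_add, Fin.val_one', Nat.add_mod_mod]
      exact Function.IsPeriodicPt.iterate_mod_apply (sigmaT_iterate_self p (c m)) _
  · rw [Fintype.sum_option]
    have h := hc m
    rw [normT, eq_sub_iff_add_eq] at h
    rw [← h, add_comm]
    congr 1
    exact (Fin.sum_univ_eq_sum_range (fun l => (sigmaT M p)^[l] (c m)) p).symm

/-- The sum over all colourings `Fin (p^(k+1)) → Fin r` agrees, modulo the transfer, with the sum
over the colourings that are periodic with period `p^k`. -/
theorem tpowTo_sub_sum_periodic_mem_range (hp : p.Prime) (i k : ℕ) {r : ℕ} (a : Fin r → ℤ → M)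
    (h : p ^ i * p ^ (k + 1) = p ^ (i + k + 1)) :
    ∃ z, tpowTo (∑ α, elemT (p ^ i) (a α)) (p ^ (k + 1)) h -
        ∑ t : Fin (p ^ k) → Fin r, elemT (p ^ (i + k + 1)) (fun z =>
          a (twExt 1 t (z / (p ^ i : ℕ))) (z % (p ^ i : ℕ))) =
      ∑ l ∈ Finset.range (p ^ (k + 1)), (sigmaT M (p ^ (i + k + 1)))^[p ^ i * l] z := by
  classical
  have hP : ((p ^ i : ℕ) : ℤ) ≠ 0 := by exact_mod_cast NeZero.ne (p ^ i)
  set e : (Fin (p ^ (k + 1)) → Fin r) → Fin (p ^ (k + 1)) → Fin r := twShift 1 1 with he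
  set T : (Fin (p ^ (k + 1)) → Fin r) → Tp M (p ^ (i + k + 1)) := fun t =>
    elemT (p ^ (i + k + 1)) (fun z => a (twExt 1 t (z / (p ^ i : ℕ))) (z % (p ^ i : ℕ))) with hTdef
  have hid : e^[p ^ (k + 1)] = id := by
    funext t
    have := twShift_mul (N := p ^ (k + 1)) (1 : Equiv.Perm (Fin r)) 1 t
    rw [he, twShift_iterate]
    simpa using this
  have hT : ∀ t, T (e t) = ((sigmaT M (p ^ (i + k + 1))).toLinearMap ^ p ^ i).toAddMonoidHom
      (T t) := by
    intro t
    rw [LinearMap.toAddMonoidHom_coe, Module.End.coe_pow, LinearEquiv.coe_toLinearMap, hTdef]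
    dsimp only
    rw [sigmaT_iterate_elemT]
    · congr 1
      funext z
      have hz : z - (p ^ i : ℕ) = z + (p ^ i : ℕ) * (-1) := by ring
      rw [hz, Int.add_mul_emod_self_left, Int.add_mul_ediv_left _ _ hP, he, twExt_twShift]
      rfl
    · intro z
      have hz : z - (p ^ (i + k + 1) : ℕ) = z + (p ^ i : ℕ) * (-(p ^ (k + 1) : ℕ)) := by
        push_cast
        ring
      rw [hz, Int.add_mul_emod_self_left, Int.add_mul_ediv_left _ _ hP, ← sub_eq_add_neg,
        twExt_sub]
      rfl
  obtain ⟨z, hz⟩ := sum_sub_sum_fixed_mem_range hp k e hid _ T hT Finset.univ (by simp)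
  refine ⟨z, ?_⟩
  rw [tpowTo_sum_elemT]
  have hfix : ∑ t with e^[p ^ k] t = t, T t =
      ∑ t : Fin (p ^ k) → Fin r, elemT (p ^ (i + k + 1)) (fun z =>
          a (twExt 1 t (z / (p ^ i : ℕ))) (z % (p ^ i : ℕ))) := by
    have hper : ∀ (t : Fin (p ^ k) → Fin r) (z m : ℤ),
        twExt 1 t (z + (p ^ k : ℕ) * m) = twExt 1 t z := fun t z m => by
      rw [twExt_add_mul, one_zpow, Equiv.Perm.one_apply]
    have hres : ∀ (t : Fin (p ^ k) → Fin r) (z : ℤ),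
        twExt 1 (fun x : Fin (p ^ (k + 1)) => twExt 1 t x) z = twExt 1 t z := by
      intro t z
      have hz : z = z % (p ^ (k + 1) : ℕ) + (p ^ k : ℕ) * (p * (z / (p ^ (k + 1) : ℕ))) := by
        rw [← mul_assoc, ← Nat.cast_mul, ← pow_succ, Int.emod_add_mul_ediv]
      conv_rhs => rw [hz, hper]
      rw [twExt, one_zpow, Equiv.Perm.one_apply, Fin.intCast_val_ofNat_toNat_emod]
    refine (Finset.sum_bij (fun t _ => fun x : Fin (p ^ (k + 1)) => twExt 1 t x) ?_ ?_ ?_ ?_).symm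
    · intro t _
      rw [Finset.mem_filter, he, twShift_iterate]
      refine ⟨Finset.mem_univ _, funext fun x => ?_⟩
      rw [twShift, hres]
      simpa [sub_eq_add_neg] using hper t x (-1)
    · intro t _ t' _ htt
      funext x
      have := congrArg (fun f => twExt 1 f (x : ℤ)) htt
      simpa [hres, twExt_val] using this
    · intro t ht
      rw [Finset.mem_filter, he, twShift_iterate] at ht
      have hp1 : ∀ z, twExt 1 t (z - (p ^ k : ℕ)) = twExt 1 t z := fun z => by
        conv_rhs => rw [← ht.2]
        rw [twExt_twShift, mul_one]
      have hp2 : ∀ z (m : ℤ), twExt 1 t (z + m * (p ^ k : ℕ)) = twExt 1 t z := by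
        have : Function.Periodic (twExt 1 t) ((p ^ k : ℕ) : ℤ) := fun z => by
          rw [← hp1, add_sub_cancel_right]
        exact fun z m => this.int_mul m z
      refine ⟨fun x => twExt 1 t x, Finset.mem_univ _, funext fun x => ?_⟩
      rw [twExt, one_zpow, Equiv.Perm.one_apply, Fin.intCast_val_ofNat_toNat_emod,
        ← hp2 _ ((x : ℤ) / (p ^ k : ℕ)), mul_comm, Int.emod_add_mul_ediv, twExt_val]
    · intro t _
      simp only [hTdef, hres]
  rw [hfix] at hz
  rw [hz]
  refine Finset.sum_congr rfl fun l _ => ?_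
  rw [LinearMap.toAddMonoidHom_coe, Module.End.coe_pow, LinearEquiv.coe_toLinearMap,
    Function.iterate_mul]

/-- Applying the higher Frobenius to a sum of `p^k`-th powers only leaves, modulo the transfer, the
contribution of the `p`-th powers of the factors. -/
theorem higherFrob_tpowTo_sub_sum_mem_range (hp : p.Prime) (φ : ExternalFrobenius p M) (i k : ℕ)
    {r : ℕ} (a : Fin r → ℤ → M) (h : p ^ i * p ^ k = p ^ (i + k)) :
    ∃ z, higherFrob p φ.toFun (i + k) (tpowTo (∑ α, elemT (p ^ i) (a α)) (p ^ k) h) -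
        ∑ t : Fin (p ^ k) → Fin r, elemT (p ^ (i + k + 1)) (fun z =>
          a (twExt 1 t (z / (p ^ i : ℕ))) (z % (p ^ i : ℕ))) =
      ∑ l ∈ Finset.range (p ^ (k + 1)), (sigmaT M (p ^ (i + k + 1)))^[p ^ i * l] z := by
  classical
  obtain ⟨u, hu_none, hu_rot, hu_sum⟩ := φ.exists_eq_sum
  have hP : ((p ^ i : ℕ) : ℤ) ≠ 0 := by exact_mod_cast NeZero.ne (p ^ i)
  set S := (Fin (p ^ k) → Fin r) × (Fin (p ^ (i + k)) → Option (Fin p))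
  set e : S → S := Prod.map (twShift 1 1) (twShift (optRot p) (p ^ i : ℕ)) with he
  have heiter : ∀ l s, e^[l] s = (twShift 1 l s.1, twShift (optRot p) (p ^ i * l : ℕ) s.2) := by
    intro l s
    rw [he, Prod.map_iterate, Prod.map_apply, twShift_iterate, twShift_iterate]
    congr 2
    · simp
    · push_cast
      ring
  set v : S → ℤ → Tp M p := fun s z =>
    u (a (twExt 1 s.1 (z / (p ^ i : ℕ))) (z % (p ^ i : ℕ))) (twExt (optRot p) s.2 z) with hv
  set T : S → Tp M (p ^ (i + k + 1)) := fun s => glue p M (i + k) fun q => v s q with hTdef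
  have hfst : ∀ (t : Fin (p ^ k) → Fin r) m, twShift 1 (p ^ k * m : ℕ) t = t := fun t m => by
    rw [twShift_mul, one_pow]
    rfl
  have hvper : ∀ s z, v s (z - (p ^ (i + k) : ℕ)) = sigmaT M p (v s z) := by
    intro s z
    have hz : z - (p ^ (i + k) : ℕ) = z + (p ^ i : ℕ) * (-(p ^ k : ℕ)) := by
      push_cast
      ring
    simp only [hv]
    rw [← hu_rot, twExt_sub, hz, Int.add_mul_emod_self_left, Int.add_mul_ediv_left _ _ hP,
      ← sub_eq_add_neg, twExt_sub]
    rfl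
  have hid : e^[p ^ (k + 1)] = id := by
    funext s
    rw [heiter, pow_succ, hfst, ← mul_assoc, ← pow_add, twShift_mul, optRot_pow_self]
    rfl
  have hT : ∀ s, T (e s) = ((sigmaT M (p ^ (i + k + 1))).toLinearMap ^ p ^ i).toAddMonoidHom
      (T s) := by
    intro s
    rw [LinearMap.toAddMonoidHom_coe, Module.End.coe_pow, LinearEquiv.coe_toLinearMap, hTdef]
    dsimp only
    rw [sigmaT_iterate_glue p (i + k) (v s) (hvper s)]
    congr 1
    funext q
    have hz : (q : ℤ) - (p ^ i : ℕ) = q + (p ^ i : ℕ) * (-1) := by ring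
    simp only [hv, he, Prod.map_fst, Prod.map_snd, twExt_twShift]
    rw [hz, Int.add_mul_emod_self_left, Int.add_mul_ediv_left _ _ hP, sub_eq_add_neg]
  obtain ⟨z, hz⟩ := sum_sub_sum_fixed_mem_range hp k e hid _ T hT Finset.univ (by simp)
  have hsum : higherFrob p φ.toFun (i + k) (tpowTo (∑ α, elemT (p ^ i) (a α)) (p ^ k) h) =
      ∑ s, T s := by
    rw [tpowTo_sum_elemT, map_sum, Fintype.sum_prod_type]
    refine Finset.sum_congr rfl fun t _ => ?_
    rw [elemT, higherFrob_tprod]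
    simp only [hu_sum]
    rw [MultilinearMap.map_sum]
    refine Finset.sum_congr rfl fun ε _ => ?_
    simp only [hTdef, hv, twExt_val]
  have hfix : ∑ s with e^[p ^ k] s = s, T s =
      ∑ t : Fin (p ^ k) → Fin r, elemT (p ^ (i + k + 1)) (fun z =>
          a (twExt 1 t (z / (p ^ i : ℕ))) (z % (p ^ i : ℕ))) := by
    have hmem : ∀ s : S, e^[p ^ k] s = s ↔ s.2 = fun _ => none := by
      intro s
      have h1 := hfst s.1 1
      have h2 := twShift_mul (N := p ^ (i + k)) (optRot p) 1 s.2
      rw [mul_one] at h1 h2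
      rw [heiter, ← pow_add, h1, h2, Prod.ext_iff]
      simp [funext_iff, optRot_eq_self_iff p hp]
    refine (Finset.sum_bij (fun t _ => ((t, fun _ => none) : S)) ?_ ?_ ?_ ?_).symm
    · intro t _
      simp [hmem]
    · intro t _ t' _ htt
      exact congrArg Prod.fst htt
    · intro s hs
      rw [Finset.mem_filter, hmem] at hs
      exact ⟨s.1, Finset.mem_univ _, Prod.ext rfl hs.2.symm⟩
    · intro t _
      have hnone : ∀ z, twExt (optRot p) (fun _ : Fin (p ^ (i + k)) => none) z = none :=
        fun z => Equiv.Perm.zpow_apply_eq_self_of_apply_eq_self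
          ((optRot_eq_self_iff p hp _).2 rfl) _
      simp only [hTdef, hv, hnone, hu_none]
      rw [glue_elemT p (i + k) fun q _ => a (twExt 1 t (q / (p ^ i : ℕ))) (q % (p ^ i : ℕ))]
      congr 1
      funext z
      set w := z % (p ^ (i + k) : ℕ) with hw
      have hzw : z = w + (p ^ i : ℕ) * ((p ^ k : ℕ) * (z / (p ^ (i + k) : ℕ))) := by
        rw [← mul_assoc, ← Nat.cast_mul, ← pow_add, hw, Int.emod_add_mul_ediv]
      rw [hzw, Int.add_mul_emod_self_left, Int.add_mul_ediv_left _ _ hP, twExt_add_mul]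
      simp
  refine ⟨z, ?_⟩
  rw [hsum, ← hfix, hz]
  refine Finset.sum_congr rfl fun l _ => ?_
  rw [LinearMap.toAddMonoidHom_coe, Module.End.coe_pow, LinearEquiv.coe_toLinearMap,
    Function.iterate_mul]

end Congruence

/-- `y^{⊗p^(k+1)}` is the higher Frobenius of `y^{⊗p^k}` up to a transfer. -/
theorem exists_tpowTo_sub_higherFrob_tpowTo (p : ℕ) [NeZero p] (hp : p.Prime) {M : Type*}
    [AddCommGroup M] (φ : ExternalFrobenius p M) (i k : ℕ) (y : Tp M (p ^ i))
    (h : p ^ i * p ^ k = p ^ (i + k)) (h' : p ^ i * p ^ (k + 1) = p ^ (i + k + 1)) :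
    ∃ z, tpowTo y (p ^ (k + 1)) h' - higherFrob p φ.toFun (i + k) (tpowTo y (p ^ k) h) =
      ∑ l ∈ Finset.range (p ^ (k + 1)), (sigmaT M (p ^ (i + k + 1)))^[p ^ i * l] z := by
  obtain ⟨r, a, -, rfl⟩ := exists_eq_sum_elemT (NeZero.pos (p ^ i)) y
  obtain ⟨z₁, h₁⟩ := tpowTo_sub_sum_periodic_mem_range p hp i k a h'
  obtain ⟨z₂, h₂⟩ := higherFrob_tpowTo_sub_sum_mem_range p hp φ i k a h
  refine ⟨z₁ - z₂, ?_⟩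
  simp only [iterate_map_sub, Finset.sum_sub_distrib]
  rw [← h₁, ← h₂, sub_sub_sub_cancel_right]

section Dwork

/-- The norm map `normT` as an additive homomorphism. -/
noncomputable def normTHom (A : Type*) [AddCommGroup A] (m : ℕ) [NeZero m] : Tp A m →+ Tp A m where
  toFun := normT A m
  map_zero' := by simp [normT, iterate_map_zero]
  map_add' x y := by simp [normT, iterate_map_add, Finset.sum_add_distrib]

variable (p : ℕ) [NeZero p] (M : Type*) [AddCommGroup M]

/-- The common shape of `ghost` and `fw`: the map with `j`-th component
`Σ_{i=0}^{j} Σ_{l=0}^{p^i - 1} σ_j^l (t_{i,j} (m_i))`. -/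
noncomputable def transferSum (t : ∀ i j : ℕ, i ≤ j → Tp M (p ^ i) → Tp M (p ^ j)) (n : ℕ)
    (m : ∀ i : Fin n, Tp M (p ^ (i : ℕ))) : ∀ j : Fin n, Tp M (p ^ (j : ℕ)) :=
  fun j => ∑ i : Fin n,
    if h : (i : ℕ) ≤ (j : ℕ) then
      ∑ l ∈ Finset.range (p ^ (i : ℕ)), (⇑(sigmaT M (p ^ (j : ℕ))))^[l] (t i j h (m i))
    else 0

variable {p M} {t : ∀ i j : ℕ, i ≤ j → Tp M (p ^ i) → Tp M (p ^ j)}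

theorem transferSum_update_of_lt {n : ℕ} (m : ∀ i : Fin n, Tp M (p ^ (i : ℕ))) {j k : Fin n}
    (hjk : j < k) (x : Tp M (p ^ (k : ℕ))) :
    transferSum p M t n (Function.update m k x) j = transferSum p M t n m j := by
  refine Finset.sum_congr rfl fun i _ => ?_
  by_cases hik : i = k
  · subst hik
    have h : ¬ (i : ℕ) ≤ j := not_le.2 hjk
    rw [dif_neg h, dif_neg h]
  · rw [Function.update_of_ne hik]

theorem transferSum_update_self (ht : ∀ i y, t i i le_rfl y = y) {n : ℕ}
    (m : ∀ i : Fin n, Tp M (p ^ (i : ℕ))) (k : Fin n) (x : Tp M (p ^ (k : ℕ))) :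
    transferSum p M t n (Function.update m k x) k =
      transferSum p M t n m k + normTHom M (p ^ (k : ℕ)) (x - m k) := by
  rw [← sub_eq_iff_eq_add', transferSum, transferSum, ← Finset.sum_sub_distrib,
    Finset.sum_eq_single k]
  · rw [dif_pos le_rfl, dif_pos le_rfl, ht, ht, Function.update_self, map_sub]
    rfl
  · intro i _ hik
    rw [Function.update_of_ne hik, sub_self]
  · simp

/-- If each term of `transferSum` commutes with the higher Frobenius modulo the norm map, so does
`transferSum`. -/
theorem transferSum_succ_sub_mem_range {φ : M →+ Tp M p} (ht : ∀ i y, t i i le_rfl y = y)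
    (hstep : ∀ i j (h : i ≤ j) y,
      ∑ l ∈ Finset.range (p ^ i), (sigmaT M (p ^ (j + 1)))^[l] (t i (j + 1) (h.trans j.le_succ) y) -
        higherFrob p φ j (∑ l ∈ Finset.range (p ^ i), (sigmaT M (p ^ j))^[l] (t i j h y)) ∈
      (normTHom M (p ^ (j + 1))).range)
    {n : ℕ} (m : ∀ i : Fin n, Tp M (p ^ (i : ℕ))) (j : ℕ) (hj : j + 1 < n) :
    transferSum p M t n m ⟨j + 1, hj⟩ -
      higherFrob p φ j (transferSum p M t n m ⟨j, j.lt_succ_self.trans hj⟩) ∈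
        (normTHom M (p ^ (j + 1))).range := by
  rw [transferSum, transferSum, map_sum, ← Finset.sum_sub_distrib]
  refine AddSubgroup.sum_mem _ fun i _ => ?_
  rcases lt_trichotomy (i : ℕ) (j + 1) with h | h | h
  · have hij := Nat.lt_succ_iff.1 h
    rw [dif_pos h.le, dif_pos hij]
    exact hstep i j hij (m i)
  · obtain rfl : i = ⟨j + 1, hj⟩ := Fin.ext h
    rw [dif_pos le_rfl, dif_neg (by simp), map_zero, sub_zero, ht]
    exact ⟨m ⟨j + 1, hj⟩, rfl⟩
  · rw [dif_neg (not_le.2 h), dif_neg (by dsimp only; omega), map_zero, sub_zero]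
    exact zero_mem _

/-- Dwork's lemma: the image of `transferSum` is cut out by congruences modulo the norm maps. -/
theorem range_transferSum {φ : M →+ Tp M p} (ht : ∀ i y, t i i le_rfl y = y)
    (hstep : ∀ i j (h : i ≤ j) y,
      ∑ l ∈ Finset.range (p ^ i), (sigmaT M (p ^ (j + 1)))^[l] (t i (j + 1) (h.trans j.le_succ) y) -
        higherFrob p φ j (∑ l ∈ Finset.range (p ^ i), (sigmaT M (p ^ j))^[l] (t i j h y)) ∈
      (normTHom M (p ^ (j + 1))).range) (n : ℕ) :
    Set.range (transferSum p M t n) = {b | ∀ (j : ℕ) (hj : j + 1 < n),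
      b ⟨j + 1, hj⟩ - higherFrob p φ j (b ⟨j, j.lt_succ_self.trans hj⟩) ∈
        (normTHom M (p ^ (j + 1))).range} := by
  have hmem := fun m => transferSum_succ_sub_mem_range ht hstep (n := n) m
  refine Set.Subset.antisymm (Set.range_subset_iff.2 hmem) fun b hb => ?_
  have hpartial : ∀ k ≤ n, ∃ m, ∀ j : Fin n, (j : ℕ) < k → transferSum p M t n m j = b j := by
    intro k
    induction k with
    | zero => exact fun _ => ⟨0, fun j hj => absurd hj (Nat.not_lt_zero _)⟩
    | succ k ih =>
      intro hk
      obtain ⟨m, hm⟩ := ih (Nat.le_of_succ_le hk)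
      obtain ⟨z, hz⟩ : b ⟨k, hk⟩ - transferSum p M t n m ⟨k, hk⟩ ∈ (normTHom M (p ^ k)).range := by
        cases k with
        | zero => exact ⟨b ⟨0, hk⟩ - transferSum p M t n m ⟨0, hk⟩, Finset.sum_range_one _⟩
        | succ j =>
          have h := sub_mem (hb j hk) (hmem m j hk)
          rwa [hm ⟨j, _⟩ j.lt_succ_self, sub_sub_sub_cancel_right] at h
      refine ⟨Function.update m ⟨k, hk⟩ (m ⟨k, hk⟩ + z), fun j hj => ?_⟩
      rcases Nat.lt_succ_iff_lt_or_eq.1 hj with h | h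
      · rw [transferSum_update_of_lt m (show j < ⟨k, hk⟩ from h), hm j h]
      · obtain rfl : j = ⟨k, hk⟩ := Fin.ext h
        rw [transferSum_update_self ht, add_sub_cancel_left, hz, add_sub_cancel]
  obtain ⟨m, hm⟩ := hpartial n le_rfl
  exact ⟨m, funext fun j => hm j j.2⟩

theorem higherFrob_sigmaT_iterate (φ : ExternalFrobenius p M) (n l : ℕ) (y : Tp M (p ^ n)) :
    higherFrob p φ.toFun n ((sigmaT M (p ^ n))^[l] y) =
      (sigmaT M (p ^ (n + 1)))^[l] (higherFrob p φ.toFun n y) :=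
  Function.Semiconj.iterate_right (fun x => higherFrob_sigmaT p φ n x) l y

theorem tcast_iterFrob_succ (φ : M →+ Tp M p) (i j d e : ℕ) (hd : i + d = j) (he : e = d + 1)
    (h : p ^ (i + d) = p ^ j) (h' : p ^ (i + e) = p ^ (j + 1)) (y : Tp M (p ^ i)) :
    tcast (A := M) h' (iterFrob p φ i e y) =
      higherFrob p φ j (tcast (A := M) h (iterFrob p φ i d y)) := by
  subst hd he
  simp [tcast, iterFrob]

theorem tcast_iterFrob_zero (φ : M →+ Tp M p) (i d : ℕ) (hd : d = 0) (h : p ^ (i + d) = p ^ i)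
    (y : Tp M (p ^ i)) : tcast (A := M) h (iterFrob p φ i d y) = y := by
  subst hd
  simp [tcast, iterFrob]

theorem range_fw (φ : ExternalFrobenius p M) (n : ℕ) :
    Set.range (fw p M φ.toFun n) = {b | ∀ (j : ℕ) (hj : j + 1 < n),
      b ⟨j + 1, hj⟩ - higherFrob p φ.toFun j (b ⟨j, j.lt_succ_self.trans hj⟩) ∈
        (normTHom M (p ^ (j + 1))).range} := by
  refine range_transferSum (t := fun i j h y =>
    tcast (A := M) (by rw [Nat.add_sub_cancel' h]) (iterFrob p φ.toFun i (j - i) y)) ?_ ?_ n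
  · exact fun i y => tcast_iterFrob_zero φ.toFun i _ (Nat.sub_self i) _ y
  · intro i j h y
    rw [map_sum]
    simp only [higherFrob_sigmaT_iterate]
    rw [tcast_iterFrob_succ φ.toFun i j (j - i) (j + 1 - i) (by omega) (by omega)
      (by rw [Nat.add_sub_cancel' h]), sub_self]
    exact zero_mem _

theorem tpowTo_one {i B : ℕ} (hB : B = 1) (h : p ^ i * B = p ^ i) (y : Tp M (p ^ i)) :
    tpowTo y B h = y := by
  subst hB
  obtain ⟨r, a, -, rfl⟩ := exists_eq_sum_elemT (NeZero.pos (p ^ i)) y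
  rw [tpowTo_sum_elemT]
  refine Fintype.sum_equiv (Equiv.funUnique (Fin 1) (Fin r)) _ _ fun t => ?_
  refine congrArg (PiTensorProduct.tprod ℤ) (funext fun x : Fin (p ^ i) => ?_)
  have hx : (x : ℤ) < (p ^ i : ℕ) := Int.ofNat_lt.2 x.2
  have h0 := twExt_val (1 : Equiv.Perm (Fin r)) t 0
  dsimp only
  rw [Int.ediv_eq_zero_of_lt (Int.natCast_nonneg _) hx, Int.emod_eq_of_lt (Int.natCast_nonneg _) hx]
  exact congrArg (fun α => a α x) h0

theorem range_ghost (hp : p.Prime) (φ : ExternalFrobenius p M) (n : ℕ) :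
    Set.range (ghost p M n) = {b | ∀ (j : ℕ) (hj : j + 1 < n),
      b ⟨j + 1, hj⟩ - higherFrob p φ.toFun j (b ⟨j, j.lt_succ_self.trans hj⟩) ∈
        (normTHom M (p ^ (j + 1))).range} := by
  refine range_transferSum (t := fun i j h y =>
    tpowTo y (p ^ (j - i)) (by rw [← pow_add, Nat.add_sub_cancel' h])) ?_ ?_ n
  · exact fun i y => tpowTo_one (by simp) _ y
  · intro i j h y
    obtain ⟨k, rfl⟩ := Nat.exists_eq_add_of_le h
    have hd : i + k - i = k := by omega
    have hd' : i + k + 1 - i = k + 1 := by omega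
    simp only [hd, hd']
    obtain ⟨z, hz⟩ := exists_tpowTo_sub_higherFrob_tpowTo p hp φ i k y
      (by rw [pow_add]) (by rw [← pow_add, add_assoc])
    refine ⟨z, ?_⟩
    rw [map_sum]
    simp only [higherFrob_sigmaT_iterate]
    rw [← Finset.sum_sub_distrib]
    simp only [← iterate_map_sub, hz]
    change normT M (p ^ (i + k + 1)) z = _
    have hcomp : ∀ l (f : ℕ → Tp M (p ^ (i + k + 1))) (s : Finset ℕ),
        (sigmaT M (p ^ (i + k + 1)))^[l] (∑ x ∈ s, f x) =
          ∑ x ∈ s, (sigmaT M (p ^ (i + k + 1)))^[l] (f x) := fun l f s => by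
      rw [← LinearEquiv.coe_toLinearMap, ← Module.End.coe_pow, map_sum]
    simp only [normT, hcomp, ← Function.iterate_add_apply]
    rw [show Finset.range (p ^ (i + k + 1)) = Finset.range (p ^ i * p ^ (k + 1)) by
      rw [← pow_add, add_assoc], sum_range_mul_eq]
    simp only [add_comm]

end Dwork

/-- let `p` be a prime, `M` an abelian group with an external Frobenius `φ`,
and `n ≥ 1`.  The image of `f^w` equals the image of the ghost map `w`; that is, a tuple `b`
admits a preimage under `w` if and only if it admits a preimage under `f^w`. -/
theorem statement11 (p : ℕ) [NeZero p] (hp : p.Prime) (M : Type*) [AddCommGroup M]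
    (φ : ExternalFrobenius p M) (n : ℕ) (hn : 1 ≤ n) :
    Set.range (fw p M φ.toFun n) = Set.range (ghost p M n) := by
  rw [range_fw, range_ghost hp φ]
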